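/- arXiv:2112.06760 — 6 statements merged into one kernel-verified Lean document; each statement's English description precedes it below -/
import Mathlib

section
/- Let N, c, r be positive integers, let X_1, ..., X_N and M be real c×r matrices, let Σ_c be a positive definite c×c matrix, Σ_r a positive definite r×r matrix, and ν > 0. Define δ_n = tr(Σ_c⁻¹(X_n−M)Σ_r⁻¹(X_n−M)') and the expected weights w_n = (ν+cr)/(ν+δ_n) for n = 1, ..., N. If the fixed-point equation Σ_c = (1/(N r)) ∑_{n=1}^N w_n (X_n−M) Σ_r⁻¹ (X_n−M)' holds, then the average expected weight equals 1, i.e. (1/N) ∑_{n=1}^N w_n = 1. (Proposition 1: at the ML estimate of the matrix-variate t distribution, the average expected weight over all N matrix observations equals 1.) -/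
open Matrix

open scoped MatrixOrder in
/-- The trace of a product of two real positive semidefinite matrices is nonnegative. -/
theorem Matrix.PosSemidef.trace_mul_nonneg_real {n : Type*} [Fintype n]
    {A B : Matrix n n ℝ} (hA : A.PosSemidef) (hB : B.PosSemidef) :
    0 ≤ (A * B).trace := by
  classical
  obtain ⟨K, rfl⟩ := CStarAlgebra.nonneg_iff_eq_star_mul_self.mp hA.nonneg
  rw [Matrix.star_eq_conjTranspose, Matrix.mul_assoc, Matrix.trace_mul_comm]
  exact (hB.mul_mul_conjTranspose_same K).trace_nonneg

/-- **Proposition 1.** At the ML estimate of the matrix-variate t distribution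
(i.e., when the fixed-point equation for Σ_c holds), the average expected weight
over all `N` matrix observations equals 1. -/
theorem avg_expected_weight_eq_one
    (N c r : ℕ) (hN : 0 < N) (hc : 0 < c) (hr : 0 < r)
    (X : Fin N → Matrix (Fin c) (Fin r) ℝ) (M : Matrix (Fin c) (Fin r) ℝ)
    (Sc : Matrix (Fin c) (Fin c) ℝ) (Sr : Matrix (Fin r) (Fin r) ℝ)
    (hSc : Sc.PosDef) (hSr : Sr.PosDef) (ν : ℝ) (hν : 0 < ν)
    (δ w : Fin N → ℝ)
    (hδ : ∀ n, δ n = (Sc⁻¹ * (X n - M) * Sr⁻¹ * (X n - M)ᵀ).trace)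
    (hw : ∀ n, w n = (ν + (c : ℝ) * r) / (ν + δ n))
    (hfix : Sc = (1 / ((N : ℝ) * r)) • ∑ n, w n • ((X n - M) * Sr⁻¹ * (X n - M)ᵀ)) :
    (1 / (N : ℝ)) * ∑ n, w n = 1 := by
  have hδ' (n) : δ n = (Sc⁻¹ * ((X n - M) * Sr⁻¹ * (X n - M)ᵀ)).trace := by
    rw [hδ]; simp only [Matrix.mul_assoc]
  have hδ_nonneg (n) : 0 ≤ δ n := by
    rw [hδ' n, ← Matrix.conjTranspose_eq_transpose_of_trivial]
    exact hSc.inv.posSemidef.trace_mul_nonneg_real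
      (hSr.inv.posSemidef.mul_mul_conjTranspose_same _)
  have hweight (n) : ν * w n + w n * δ n = ν + (c : ℝ) * r := by
    have hpos : ν + δ n ≠ 0 := by linarith [hδ_nonneg n]
    rw [hw n]
    field_simp
  have htrace : (c : ℝ) = 1 / ((N : ℝ) * r) * ∑ n, w n * δ n := by
    have h := congrArg (fun A => (Sc⁻¹ * A).trace) hfix
    simpa [-Matrix.transpose_sub, Matrix.mul_assoc, Matrix.nonsing_inv_mul Sc ((Matrix.isUnit_iff_isUnit_det Sc).mp hSc.isUnit),
      Matrix.mul_sum, Matrix.trace_sum, hδ'] using h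
  have hsum := Finset.sum_congr (rfl : (Finset.univ : Finset (Fin N)) = _)
    fun n _ => hweight n
  rw [Finset.sum_add_distrib, ← Finset.mul_sum, Finset.sum_const, Finset.card_univ,
    Fintype.card_fin, nsmul_eq_mul] at hsum
  have hN' : (N : ℝ) ≠ 0 := by positivity
  have hr' : (r : ℝ) ≠ 0 := by positivity
  field_simp at htrace ⊢
  apply mul_left_cancel₀ hν.ne'
  linarith
end

section
/- Let c, r be positive integers, X, M real c×r matrices, Σ_c a positive definite c×c matrix, Σ_r a positive definite r×r matrix, ν > 0, and let δ = tr(Σ_c⁻¹(X−M)Σ_r⁻¹(X−M)'). Then the conditional expectation of the latent weight, defined as the ratio of integrals E[τ|X] = (∫_0^∞ τ · N_{c,r}(X; M, Σ_c/τ, Σ_r) Gam(τ; ν/2, ν/2) dτ) / (∫_0^∞ N_{c,r}(X; M, Σ_c/τ, Σ_r) Gam(τ; ν/2, ν/2) dτ), equals (ν+cr)/(ν+δ). -/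
open Matrix MeasureTheory

/-- The Gamma density with shape `α` and rate `β`. -/
noncomputable def gammaPdf (α β τ : ℝ) : ℝ :=
  β ^ α / Real.Gamma α * τ ^ (α - 1) * Real.exp (-β * τ)

/-- The matrix-normal density `N_{c,r}(X; M, Sc, Sr)`. -/
noncomputable def matNormalPdf {c r : ℕ} (X M : Matrix (Fin c) (Fin r) ℝ)
    (Sc : Matrix (Fin c) (Fin c) ℝ) (Sr : Matrix (Fin r) (Fin r) ℝ) : ℝ :=
  (2 * Real.pi) ^ (-((c * r : ℕ) : ℝ) / 2) * Sc.det ^ (-(r : ℝ) / 2) * Sr.det ^ (-(c : ℝ) / 2) *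
    Real.exp (-(1 / 2) * (Sc⁻¹ * (X - M) * Sr⁻¹ * (X - M)ᵀ).trace)

open scoped MatrixOrder in
theorem trace_mul_nonneg_of_posSemidef {m n : Type*} [Fintype m] [Fintype n]
    {P : Matrix m m ℝ} {Q : Matrix n n ℝ} (hP : P.PosSemidef) (hQ : Q.PosSemidef)
    (A : Matrix m n ℝ) : 0 ≤ (P * A * Q * Aᵀ).trace := by
  classical
  obtain ⟨B, rfl⟩ := CStarAlgebra.nonneg_iff_eq_star_mul_self.mp hP.nonneg
  rw [Matrix.star_eq_conjTranspose]
  have h := (hQ.mul_mul_conjTranspose_same (B * A)).trace_nonneg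
  rw [Matrix.conjTranspose_mul, ← Matrix.mul_assoc, Matrix.trace_mul_comm] at h
  simpa [Matrix.mul_assoc, Matrix.conjTranspose_eq_transpose_of_trivial] using h

/-- The joint density of the observation and the latent weight is, as a function of the weight,
proportional to a Gamma density with shape `(ν + cr)/2` and rate `(ν + δ)/2`. -/
theorem matNormalPdf_mul_gammaPdf {c r : ℕ} (X M : Matrix (Fin c) (Fin r) ℝ)
    {Sc : Matrix (Fin c) (Fin c) ℝ} (Sr : Matrix (Fin r) (Fin r) ℝ) (hSc : Sc.PosDef)
    (ν : ℝ) {τ : ℝ} (hτ : 0 < τ) :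
    matNormalPdf X M (τ⁻¹ • Sc) Sr * gammaPdf (ν / 2) (ν / 2) τ =
      ((2 * Real.pi) ^ (-((c * r : ℕ) : ℝ) / 2) * Sc.det ^ (-(r : ℝ) / 2) *
        Sr.det ^ (-(c : ℝ) / 2) * ((ν / 2) ^ (ν / 2) / Real.Gamma (ν / 2))) *
      (τ ^ ((ν + (c : ℝ) * r) / 2 - 1) *
        Real.exp (-((ν + (Sc⁻¹ * (X - M) * Sr⁻¹ * (X - M)ᵀ).trace) / 2 * τ))) := by
  have hdet : (τ⁻¹ • Sc).det ^ (-(r : ℝ) / 2) =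
      τ ^ ((c : ℝ) * r / 2) * Sc.det ^ (-(r : ℝ) / 2) := by
    rw [Matrix.det_smul, Fintype.card_fin, Real.mul_rpow (by positivity) hSc.det_pos.le,
      ← Real.rpow_natCast, ← Real.rpow_mul (by positivity), Real.inv_rpow hτ.le,
      ← Real.rpow_neg hτ.le]
    ring_nf
  have hinv : (τ⁻¹ • Sc)⁻¹ = τ • Sc⁻¹ := by
    have : Invertible τ⁻¹ := invertibleOfNonzero (inv_ne_zero hτ.ne')
    rw [Matrix.inv_smul Sc τ⁻¹ hSc.det_pos.ne'.isUnit, invOf_eq_inv, inv_inv]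
  have hpow : τ ^ ((ν + (c : ℝ) * r) / 2 - 1) = τ ^ ((c : ℝ) * r / 2) * τ ^ (ν / 2 - 1) := by
    rw [← Real.rpow_add hτ]
    ring_nf
  have hexp (d : ℝ) : Real.exp (-((ν + d) / 2 * τ)) =
      Real.exp (-(1 / 2) * (τ * d)) * Real.exp (-(ν / 2) * τ) := by
    rw [← Real.exp_add]
    ring_nf
  rw [matNormalPdf, gammaPdf, hdet, hinv, hpow, hexp]
  simp only [Matrix.smul_mul, Matrix.trace_smul, smul_eq_mul]
  ring

/-- The conditional expectation of the latent weight under Model IV equals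
`(ν + cr)/(ν + δ)`. -/
theorem conditional_expectation_latent_weight
    (c r : ℕ) (hc : 0 < c) (hr : 0 < r)
    (X M : Matrix (Fin c) (Fin r) ℝ)
    (Sc : Matrix (Fin c) (Fin c) ℝ) (Sr : Matrix (Fin r) (Fin r) ℝ)
    (hSc : Sc.PosDef) (hSr : Sr.PosDef) (ν : ℝ) (hν : 0 < ν) (δ : ℝ)
    (hδ : δ = (Sc⁻¹ * (X - M) * Sr⁻¹ * (X - M)ᵀ).trace) :
    (∫ τ in Set.Ioi (0 : ℝ), τ * (matNormalPdf X M (τ⁻¹ • Sc) Sr * gammaPdf (ν / 2) (ν / 2) τ)) /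
        (∫ τ in Set.Ioi (0 : ℝ), matNormalPdf X M (τ⁻¹ • Sc) Sr * gammaPdf (ν / 2) (ν / 2) τ)
      = (ν + (c : ℝ) * r) / (ν + δ) := by
  have hδ0 : 0 ≤ δ := hδ ▸ trace_mul_nonneg_of_posSemidef hSc.inv.posSemidef hSr.inv.posSemidef _
  have ha : 0 < (ν + (c : ℝ) * r) / 2 := by positivity
  have hb : 0 < (ν + δ) / 2 := by positivity
  have hSc0 := hSc.det_pos
  have hSr0 := hSr.det_pos
  have hΓν : 0 < Real.Gamma (ν / 2) := Real.Gamma_pos_of_pos (by positivity)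
  set K := (2 * Real.pi) ^ (-((c * r : ℕ) : ℝ) / 2) * Sc.det ^ (-(r : ℝ) / 2) *
    Sr.det ^ (-(c : ℝ) / 2) * ((ν / 2) ^ (ν / 2) / Real.Gamma (ν / 2)) with hK
  have hK0 : K ≠ 0 := by positivity
  have hden : ∫ τ in Set.Ioi (0 : ℝ), matNormalPdf X M (τ⁻¹ • Sc) Sr *
      gammaPdf (ν / 2) (ν / 2) τ =
      K * ((1 / ((ν + δ) / 2)) ^ ((ν + (c : ℝ) * r) / 2) *
        Real.Gamma ((ν + (c : ℝ) * r) / 2)) := by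
    rw [← Real.integral_rpow_mul_exp_neg_mul_Ioi ha hb, ← integral_const_mul]
    refine setIntegral_congr_fun measurableSet_Ioi fun τ hτ => ?_
    simp only [matNormalPdf_mul_gammaPdf X M Sr hSc ν hτ, ← hδ, hK]
  have hnum : ∫ τ in Set.Ioi (0 : ℝ), τ * (matNormalPdf X M (τ⁻¹ • Sc) Sr *
      gammaPdf (ν / 2) (ν / 2) τ) =
      K * ((1 / ((ν + δ) / 2)) ^ ((ν + (c : ℝ) * r) / 2 + 1) *
        Real.Gamma ((ν + (c : ℝ) * r) / 2 + 1)) := by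
    rw [← Real.integral_rpow_mul_exp_neg_mul_Ioi (add_pos ha one_pos) hb, ← integral_const_mul]
    refine setIntegral_congr_fun measurableSet_Ioi fun τ hτ => ?_
    have hpow : τ ^ ((ν + (c : ℝ) * r) / 2 + 1 - 1) =
        τ ^ ((ν + (c : ℝ) * r) / 2 - 1) * τ := by
      rw [← Real.rpow_add_one (ne_of_gt hτ)]
      ring_nf
    simp only [matNormalPdf_mul_gammaPdf X M Sr hSc ν hτ, ← hδ, hpow, ← hK]
    ring
  have hΓ : Real.Gamma ((ν + (c : ℝ) * r) / 2) ≠ 0 := (Real.Gamma_pos_of_pos ha).ne'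
  have hB : (1 / ((ν + δ) / 2)) ^ ((ν + (c : ℝ) * r) / 2) ≠ 0 := by positivity
  rw [hnum, hden, Real.Gamma_add_one ha.ne', Real.rpow_add_one (by positivity)]
  have hνδ : ν + δ ≠ 0 := by positivity
  generalize (1 / ((ν + δ) / 2)) ^ ((ν + (c : ℝ) * r) / 2) = B at hB ⊢
  field_simp
end

section
/- Let N, c, r be positive integers, X_1, ..., X_N real c×r matrices, W_1, ..., W_N positive definite c×c matrices, and Σ_r a positive definite r×r matrix. Then the function g(M) = ∑_{n=1}^N tr(W_n (X_n−M) Σ_r⁻¹ (X_n−M)') over real c×r matrices M is uniquely minimized at M̃ = (∑_{n=1}^N W_n)⁻¹ ∑_{n=1}^N W_n X_n. This is the CMQ-step 1 update of the ECME algorithm for the matrix-variate T distribution (TPCA), with W_n = E[S_n|X_n]. -/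
open Matrix

open scoped MatrixOrder in
theorem Matrix.PosDef.exists_isUnit_conjTranspose_mul_self {n : Type*} [Fintype n] [DecidableEq n]
    {A : Matrix n n ℝ} (hA : A.PosDef) : ∃ B : Matrix n n ℝ, IsUnit B ∧ A = Bᴴ * B := by
  have hnn := hA.posSemidef.nonneg
  refine ⟨CFC.sqrt A, (CFC.isUnit_sqrt_iff A hnn).2 hA.isUnit, ?_⟩
  rw [(CFC.sqrt_nonneg A).posSemidef.isHermitian.eq, CFC.sqrt_mul_sqrt_self A hnn]

theorem Matrix.PosDef.trace_mul_mul_mul_conjTranspose_pos {m n : Type*} [Fintype m] [Fintype n]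
    [DecidableEq m] [DecidableEq n] {A : Matrix m m ℝ} {P : Matrix n n ℝ}
    (hA : A.PosDef) (hP : P.PosDef) {D : Matrix m n ℝ} (hD : D ≠ 0) :
    0 < (A * D * P * Dᴴ).trace := by
  obtain ⟨B, hB, rfl⟩ := hA.exists_isUnit_conjTranspose_mul_self
  obtain ⟨C, hC, rfl⟩ := hP.exists_isUnit_conjTranspose_mul_self
  have key : (Bᴴ * B * D * (Cᴴ * C) * Dᴴ).trace = (B * D * Cᴴ * (B * D * Cᴴ)ᴴ).trace := by
    rw [Matrix.mul_assoc Bᴴ, Matrix.mul_assoc Bᴴ, Matrix.mul_assoc Bᴴ, Matrix.trace_mul_comm]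
    simp only [conjTranspose_mul, conjTranspose_conjTranspose, Matrix.mul_assoc]
  rw [key]
  refine (posSemidef_self_mul_conjTranspose _).trace_nonneg.lt_of_ne fun h => hD ?_
  rw [eq_comm, trace_mul_conjTranspose_self_eq_zero_iff] at h
  have hBdet := (isUnit_iff_isUnit_det B).1 hB
  have hCdet : IsUnit (Cᴴ).det := (isUnit_iff_isUnit_det _).1 hC.star
  rw [← Matrix.nonsing_inv_mul_cancel_left B D hBdet,
    ← Matrix.mul_nonsing_inv_cancel_right Cᴴ (B * D) hCdet, h, Matrix.zero_mul, Matrix.mul_zero]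

/-- Completing the square around a center whose weighted residuals sum to zero. -/
theorem Matrix.sum_trace_weighted_sq_eq_add {ι m n : Type*} [Fintype ι] [Fintype m] [Fintype n]
    {W : ι → Matrix m m ℝ} (hW : ∀ i, (W i)ᵀ = W i) {P : Matrix n n ℝ} (hP : Pᵀ = P)
    {X : ι → Matrix m n ℝ} {C : Matrix m n ℝ} (hC : ∑ i, W i * (X i - C) = 0)
    (M : Matrix m n ℝ) :
    ∑ i, (W i * (X i - M) * P * (X i - M)ᵀ).trace =
      ∑ i, (W i * (X i - C) * P * (X i - C)ᵀ).trace +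
        ((∑ i, W i) * (C - M) * P * (C - M)ᵀ).trace := by
  have hcross : ∑ i, (W i * (X i - C) * P * (C - M)ᵀ).trace = 0 := by
    simp [← trace_sum, ← Matrix.sum_mul, hC]
  have hterm (i : ι) : (W i * (X i - M) * P * (X i - M)ᵀ).trace =
      (W i * (X i - C) * P * (X i - C)ᵀ).trace + 2 * (W i * (X i - C) * P * (C - M)ᵀ).trace +
        (W i * (C - M) * P * (C - M)ᵀ).trace := by
    have hsymm : (W i * (C - M) * P * (X i - C)ᵀ).trace =
        (W i * (X i - C) * P * (C - M)ᵀ).trace := by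
      rw [← trace_transpose]
      simp only [transpose_mul, transpose_transpose, hW, hP]
      rw [← Matrix.mul_assoc, ← Matrix.mul_assoc, trace_mul_comm]
      simp only [Matrix.mul_assoc]
    rw [← sub_add_sub_cancel (X i) C M]
    simp only [Matrix.mul_add, Matrix.add_mul, transpose_add, trace_add, hsymm]
    ring
  simp_rw [hterm, Finset.sum_add_distrib, ← Finset.mul_sum, hcross, Matrix.sum_mul, trace_sum]
  ring

/-- CMQ-step 1 of the ECME algorithm for the matrix-variate T distribution (TPCA):
the function `g(M) = ∑ tr(W_n(X_n−M)Σ_r⁻¹(X_n−M)')` with positive definite weight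
matrices `W_n` is uniquely minimized at `M̃ = (∑ W_n)⁻¹ ∑ W_n X_n`. -/
theorem matrix_weighted_mean_uniquely_minimizes
    (N c r : ℕ) (hN : 0 < N) (hc : 0 < c) (hr : 0 < r)
    (X : Fin N → Matrix (Fin c) (Fin r) ℝ)
    (W : Fin N → Matrix (Fin c) (Fin c) ℝ) (hW : ∀ n, (W n).PosDef)
    (Sr : Matrix (Fin r) (Fin r) ℝ) (hSr : Sr.PosDef)
    (Mt : Matrix (Fin c) (Fin r) ℝ)
    (hMt : Mt = (∑ n, W n)⁻¹ * ∑ n, W n * X n) :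
    (∀ M : Matrix (Fin c) (Fin r) ℝ,
        (∑ n, (W n * (X n - Mt) * Sr⁻¹ * (X n - Mt)ᵀ).trace)
          ≤ ∑ n, (W n * (X n - M) * Sr⁻¹ * (X n - M)ᵀ).trace) ∧
    (∀ M : Matrix (Fin c) (Fin r) ℝ, M ≠ Mt →
        (∑ n, (W n * (X n - Mt) * Sr⁻¹ * (X n - Mt)ᵀ).trace)
          < ∑ n, (W n * (X n - M) * Sr⁻¹ * (X n - M)ᵀ).trace) := by
  have hS : (∑ n, W n).PosDef :=
    posDef_sum (Finset.univ_nonempty_iff.2 (Fin.pos_iff_nonempty.1 hN)) fun n _ => hW n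
  have hP := hSr.inv
  have hres : ∑ n, W n * (X n - Mt) = 0 := by
    simp_rw [Matrix.mul_sub, Finset.sum_sub_distrib, ← Matrix.sum_mul]
    rw [hMt, Matrix.mul_nonsing_inv_cancel_left _ _ ((isUnit_iff_isUnit_det _).1 hS.isUnit),
      sub_self]
  have hlt (M : Matrix (Fin c) (Fin r) ℝ) (hM : M ≠ Mt) :
      (∑ n, (W n * (X n - Mt) * Sr⁻¹ * (X n - Mt)ᵀ).trace)
        < ∑ n, (W n * (X n - M) * Sr⁻¹ * (X n - M)ᵀ).trace := by
    rw [sum_trace_weighted_sq_eq_add (fun n => by simpa using (hW n).isHermitian.eq)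
      (by simpa using hP.isHermitian.eq) hres M]
    exact lt_add_of_pos_right _ <| by
      simpa using hS.trace_mul_mul_mul_conjTranspose_pos hP (sub_ne_zero.2 hM.symm)
  refine ⟨fun M => ?_, hlt⟩
  obtain rfl | hM := eq_or_ne M Mt
  · exact le_rfl
  · exact (hlt M hM).le
end

section
/- Let c, r be positive integers, X, M real c×r matrices, Σ_c a positive definite c×c matrix, Σ_r a positive definite r×r matrix, and ν > 0. Then for every positive definite c×c matrix S, N_{c,r}(X; M, S⁻¹, Σ_r) · W_c(S; Σ_c⁻¹, ν+c−1) = T_{c,r}(X; M, Σ_c, Σ_r, ν) · W_c(S; [(X−M)Σ_r⁻¹(X−M)' + Σ_c]⁻¹, ν+c+r−1). Consequently, under Model III the posterior distribution of S given X is Wishart with scale matrix [(X−M)Σ_r⁻¹(X−M)' + Σ_c]⁻¹ and degrees of freedom ν+c+r−1. -/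
open Matrix

/-- The multivariate gamma function `Γ_d(a) = π^{d(d−1)/4} ∏_{j=1}^d Γ(a + (1−j)/2)`. -/
noncomputable def multiGamma (d : ℕ) (a : ℝ) : ℝ :=
  Real.pi ^ (((d * (d - 1) : ℕ) : ℝ) / 4) * ∏ j : Fin d, Real.Gamma (a - (j : ℝ) / 2)

/-- The Wishart density `W_d(S; Ψ, ν)` on positive definite `d×d` matrices. -/
noncomputable def wishartPdf {d : ℕ} (S Ψ : Matrix (Fin d) (Fin d) ℝ) (ν : ℝ) : ℝ :=
  S.det ^ ((ν - d - 1) / 2) * Real.exp (-(1 / 2) * (Ψ⁻¹ * S).trace) /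
    ((2 : ℝ) ^ (ν * d / 2) * Ψ.det ^ (ν / 2) * multiGamma d (ν / 2))

/-- The matrix-variate T density `T_{c,r}(X; M, Sc, Sr, ν)`. -/
noncomputable def matTTPdf {c r : ℕ} (X M : Matrix (Fin c) (Fin r) ℝ)
    (Sc : Matrix (Fin c) (Fin c) ℝ) (Sr : Matrix (Fin r) (Fin r) ℝ) (ν : ℝ) : ℝ :=
  Sr.det ^ (-(c : ℝ) / 2) * Sc.det ^ (-(r : ℝ) / 2) * multiGamma c ((ν + c + r - 1) / 2) /
      (Real.pi ^ (((c * r : ℕ) : ℝ) / 2) * multiGamma c ((ν + c - 1) / 2)) *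
    (1 + Sc⁻¹ * (X - M) * Sr⁻¹ * (X - M)ᵀ).det ^ (-(ν + c + r - 1) / 2)

theorem multiGamma_pos {d : ℕ} {a : ℝ} (ha : (d : ℝ) - 1 < 2 * a) : 0 < multiGamma d a := by
  refine mul_pos (Real.rpow_pos_of_pos Real.pi_pos _) (Finset.prod_pos fun j _ => ?_)
  have hj : ((j : ℕ) : ℝ) + 1 ≤ d := by exact_mod_cast j.isLt
  exact Real.Gamma_pos_of_pos (by linarith)

/-- Under Model III, the joint density factorizes as the matrix-variate T marginal
times the Wishart posterior of `S` given `X`, with scale matrix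
`[(X−M)Σ_r⁻¹(X−M)' + Σ_c]⁻¹` and degrees of freedom `ν+c+r−1`. -/
theorem matNormal_wishart_joint_eq_matTT_mul_wishart_posterior
    (c r : ℕ) (hc : 0 < c) (hr : 0 < r)
    (X M : Matrix (Fin c) (Fin r) ℝ)
    (Sc : Matrix (Fin c) (Fin c) ℝ) (Sr : Matrix (Fin r) (Fin r) ℝ)
    (hSc : Sc.PosDef) (hSr : Sr.PosDef) (ν : ℝ) (hν : 0 < ν) :
    ∀ S : Matrix (Fin c) (Fin c) ℝ, S.PosDef →
      matNormalPdf X M S⁻¹ Sr * wishartPdf S Sc⁻¹ (ν + c - 1)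
        = matTTPdf X M Sc Sr ν *
            wishartPdf S ((X - M) * Sr⁻¹ * (X - M)ᵀ + Sc)⁻¹ (ν + c + r - 1) := by
  intro S hS
  have hSrinv : Sr⁻¹.PosSemidef := hSr.inv.posSemidef
  have hE : ((X - M) * Sr⁻¹ * (X - M)ᵀ).PosSemidef := by
    simpa [conjTranspose_eq_transpose_of_trivial] using
      hSrinv.mul_mul_conjTranspose_same (X - M)
  have hdet : (1 + Sc⁻¹ * (X - M) * Sr⁻¹ * (X - M)ᵀ).det =
      Sc.det⁻¹ * ((X - M) * Sr⁻¹ * (X - M)ᵀ + Sc).det := by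
    rw [← Ring.inverse_eq_inv', ← det_nonsing_inv, ← det_mul, mul_add,
      nonsing_inv_mul _ hSc.det_pos.ne'.isUnit, add_comm]
    simp only [Matrix.mul_assoc]
  unfold matNormalPdf wishartPdf matTTPdf
  rw [nonsing_inv_nonsing_inv _ hS.det_pos.ne'.isUnit,
    nonsing_inv_nonsing_inv _ hSc.det_pos.ne'.isUnit,
    nonsing_inv_nonsing_inv _ (hSc.posSemidef_add hE).det_pos.ne'.isUnit, hdet]
  have ht := (hSc.posSemidef_add hE).det_pos
  have htr : (S * (X - M) * Sr⁻¹ * (X - M)ᵀ).trace = ((X - M) * Sr⁻¹ * (X - M)ᵀ * S).trace := by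
    rw [trace_mul_comm _ S]
    simp only [Matrix.mul_assoc]
  have hexp : Real.exp (-(1 / 2) * (((X - M) * Sr⁻¹ * (X - M)ᵀ + Sc) * S).trace) =
      Real.exp (-(1 / 2) * (S * (X - M) * Sr⁻¹ * (X - M)ᵀ).trace) *
        Real.exp (-(1 / 2) * (Sc * S).trace) := by
    rw [← Real.exp_add, htr, add_mul, trace_add, mul_add]
  rw [hexp]
  simp only [det_nonsing_inv, Ring.inverse_eq_inv']
  have ha := hS.det_pos
  have hs := hSc.det_pos
  have hG : multiGamma c ((ν + c + r - 1) / 2) ≠ 0 := by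
    have : (0 : ℝ) ≤ r := r.cast_nonneg
    exact (multiGamma_pos (by linarith)).ne'
  generalize ((X - M) * Sr⁻¹ * (X - M)ᵀ + Sc).det = t at *
  generalize S.det = a at *
  generalize Sc.det = s at *
  have hpi := Real.pi_pos
  have h_two_pi : (2 * Real.pi) ^ (-((c * r : ℕ) : ℝ) / 2) =
      ((2 : ℝ) ^ (((c * r : ℕ) : ℝ) / 2))⁻¹ * (Real.pi ^ (((c * r : ℕ) : ℝ) / 2))⁻¹ := by
    rw [neg_div, Real.rpow_neg (by positivity), Real.mul_rpow (by positivity) hpi.le, mul_inv]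
  have h_two : (2 : ℝ) ^ ((ν + c + r - 1) * c / 2) =
      2 ^ ((ν + c - 1) * c / 2) * 2 ^ (((c * r : ℕ) : ℝ) / 2) := by
    rw [← Real.rpow_add two_pos]
    push_cast
    ring_nf
  have h_a : a ^ ((ν + c + r - 1 - c - 1) / 2) =
      a ^ ((ν + c - 1 - c - 1) / 2) * a ^ ((r : ℝ) / 2) := by
    rw [← Real.rpow_add ha]
    ring_nf
  have h_s : s ^ ((ν + c + r - 1) / 2) = s ^ ((ν + c - 1) / 2) * s ^ ((r : ℝ) / 2) := by
    rw [← Real.rpow_add hs]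
    ring_nf
  rw [h_two_pi, h_two, h_a, Real.mul_rpow (inv_nonneg.2 hs.le) ht.le]
  simp only [neg_div _ (r : ℝ), neg_div _ (ν + c + r - 1), Real.inv_rpow ha.le,
    Real.inv_rpow hs.le, Real.inv_rpow ht.le, Real.rpow_neg ha.le, Real.rpow_neg hs.le,
    Real.rpow_neg ht.le, inv_inv, h_s]
  have := Real.rpow_pos_of_pos hs ((r : ℝ) / 2)
  have := Real.rpow_pos_of_pos ht ((ν + c + r - 1) / 2)
  field_simp
end

section
/- Let c, r be positive integers, M a real c×r matrix, Σ_c a positive definite c×c matrix, Σ_r a positive definite r×r matrix, and ν > 2. Then the covariance matrix of vec(X) under the matrix-variate t density equals (ν/(ν−2)) Σ_r ⊗ Σ_c; that is, ∫_{ℝ^{c×r}} (vec(X) − vec(M))(vec(X) − vec(M))' · Mt_{c,r}(X; M, Σ_c, Σ_r, ν) dX = (ν/(ν−2)) Σ_r ⊗ Σ_c, where the integral is over all real c×r matrices X with respect to Lebesgue measure on the cr entries. -/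
open Matrix MeasureTheory Kronecker

/-- The matrix-variate t density `Mt_{c,r}(X; M, Sc, Sr, ν)`. -/
noncomputable def matTPdf {c r : ℕ} (X M : Matrix (Fin c) (Fin r) ℝ)
    (Sc : Matrix (Fin c) (Fin c) ℝ) (Sr : Matrix (Fin r) (Fin r) ℝ) (ν : ℝ) : ℝ :=
  Sc.det ^ (-(r : ℝ) / 2) * Sr.det ^ (-(c : ℝ) / 2) * Real.Gamma ((ν + (c : ℝ) * r) / 2) /
      ((Real.pi * ν) ^ (((c * r : ℕ) : ℝ) / 2) * Real.Gamma (ν / 2)) *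
    (1 + (1 / ν) * (Sc⁻¹ * (X - M) * Sr⁻¹ * (X - M)ᵀ).trace) ^ (-(ν + (c : ℝ) * r) / 2)

/-- The vectorization of a `c×r` matrix obtained by stacking its columns. -/
def vecM {c r : ℕ} (X : Matrix (Fin c) (Fin r) ℝ) : Fin r × Fin c → ℝ := fun p => X p.2 p.1

lemma integral_sq_mul_exp_neg_mul_sq {b : ℝ} (hb : 0 < b) :
    ∫ x : ℝ, x ^ 2 * Real.exp (-b * x ^ 2) = √(Real.pi / b) * (1 / (2 * b)) := by
  have h := integral_comp_abs (f := fun x : ℝ => x ^ 2 * Real.exp (-b * x ^ 2))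
  simp only [sq_abs] at h
  have h2 := integral_rpow_mul_exp_neg_mul_rpow (p := 2) (q := 2) two_pos (by norm_num) hb
  simp only [Real.rpow_two] at h2
  rw [h, h2, show ((2 : ℝ) + 1) / 2 = 1 / 2 + 1 by norm_num,
    Real.Gamma_add_one (by norm_num), Real.Gamma_one_half_eq,
    show (-(2 + 1) / 2 : ℝ) = -(1 / 2) + -1 by norm_num, Real.rpow_add hb, Real.rpow_neg hb.le,
    ← Real.sqrt_eq_rpow, Real.rpow_neg_one, Real.sqrt_div Real.pi_pos.le]
  ring

lemma integral_mul_exp_neg_mul_sq (b : ℝ) : ∫ x : ℝ, x * Real.exp (-b * x ^ 2) = 0 := by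
  have h := integral_neg_eq_self (fun x : ℝ => x * Real.exp (-b * x ^ 2)) volume
  simp only [neg_sq, neg_mul, integral_neg] at h ⊢
  linarith

lemma integrable_sq_mul_exp_neg_mul_sq {b : ℝ} (hb : 0 < b) :
    Integrable fun x : ℝ => x ^ 2 * Real.exp (-b * x ^ 2) := by
  simpa using integrable_rpow_mul_exp_neg_mul_sq hb (s := 2) (by norm_num)

lemma integral_gamma_weight {a u : ℝ} (ha : 0 < a) (hu : 0 < u) :
    ∫ t in Set.Ioi (0 : ℝ), t ^ (a - 1) * Real.exp (-(u * t)) = u ^ (-a) * Real.Gamma a := by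
  rw [Real.integral_rpow_mul_exp_neg_mul_Ioi ha hu, one_div, Real.inv_rpow hu.le,
    Real.rpow_neg hu.le]

lemma integral_gamma_weight_mul {ι : Type*} [Fintype ι] {ν a : ℝ} (hν : 2 < ν)
    (ha : a = (ν + Fintype.card ι) / 2) (i j : ι) (y : ι → ℝ) :
    ∫ t in Set.Ioi (0 : ℝ), y i * y j *
        (t ^ (a - 1) * Real.exp (-((1 + (1 / ν) * (y ⬝ᵥ y)) * t))) =
      y i * y j * (1 + (1 / ν) * (y ⬝ᵥ y)) ^ (-a) * Real.Gamma a := by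
  have hy : 0 ≤ y ⬝ᵥ y := Finset.sum_nonneg fun k _ => mul_self_nonneg (y k)
  have hν0 : 0 < ν := by linarith
  rw [integral_const_mul, integral_gamma_weight (by rw [ha]; positivity) (by positivity),
    ← mul_assoc]

section Gaussian

variable {ι : Type*} [Fintype ι] [DecidableEq ι]

lemma mul_mul_exp_neg_mul_dotProduct_eq_prod (b : ℝ) (i j : ι) (y : ι → ℝ) :
    y i * y j * Real.exp (-b * (y ⬝ᵥ y)) =
      ∏ k, (if k = i then y k else 1) * (if k = j then y k else 1) *
        Real.exp (-b * y k ^ 2) := by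
  rw [Finset.prod_mul_distrib, Finset.prod_mul_distrib, ← Real.exp_sum, ← Finset.mul_sum]
  simp [dotProduct, sq]

lemma integrable_mul_mul_exp_neg_mul_dotProduct {b : ℝ} (hb : 0 < b) (i j : ι) :
    Integrable fun y : ι → ℝ => y i * y j * Real.exp (-b * (y ⬝ᵥ y)) := by
  simp_rw [mul_mul_exp_neg_mul_dotProduct_eq_prod]
  refine Integrable.fintype_prod (f := fun k x => (if k = i then x else 1) *
    (if k = j then x else 1) * Real.exp (-b * x ^ 2)) fun k => ?_
  split_ifs
  · simpa [sq] using integrable_sq_mul_exp_neg_mul_sq hb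
  · simpa using integrable_mul_exp_neg_mul_sq hb
  · simpa using integrable_mul_exp_neg_mul_sq hb
  · simpa using integrable_exp_neg_mul_sq hb

lemma integral_mul_mul_exp_neg_mul_dotProduct {b : ℝ} (hb : 0 < b) (i j : ι) :
    ∫ y : ι → ℝ, y i * y j * Real.exp (-b * (y ⬝ᵥ y)) =
      if i = j then √(Real.pi / b) ^ Fintype.card ι * (1 / (2 * b)) else 0 := by
  simp_rw [mul_mul_exp_neg_mul_dotProduct_eq_prod]
  rw [integral_fintype_prod_volume_eq_prod fun k x => (if k = i then x else 1) *
    (if k = j then x else 1) * Real.exp (-b * x ^ 2)]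
  split_ifs with h
  · subst h
    have (k : ι) : ∫ x : ℝ, (if k = i then x else 1) * (if k = i then x else 1) *
        Real.exp (-b * x ^ 2) = √(Real.pi / b) * (if k = i then 1 / (2 * b) else 1) := by
      split_ifs
      · simpa only [← sq] using integral_sq_mul_exp_neg_mul_sq hb
      · simpa using integral_gaussian b
    rw [Finset.prod_congr rfl fun k _ => this k]
    rw [Finset.prod_mul_distrib]
    simp
  · refine Finset.prod_eq_zero (Finset.mem_univ i) ?_
    simpa [h] using integral_mul_exp_neg_mul_sq b

lemma integral_gaussian_kernel_mul_gamma_weight {ν a t : ℝ} (hν : 0 < ν)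
    (ha : a = (ν + Fintype.card ι) / 2) (ht : 0 < t) (i j : ι) :
    ∫ y : ι → ℝ, y i * y j * (t ^ (a - 1) * Real.exp (-((1 + (1 / ν) * (y ⬝ᵥ y)) * t))) =
      (if i = j then (Real.pi * ν) ^ ((Fintype.card ι : ℝ) / 2) * (ν / 2) else 0) *
        (Real.exp (-t) * t ^ (ν / 2 - 1 - 1)) := by
  have key (y : ι → ℝ) :
      y i * y j * (t ^ (a - 1) * Real.exp (-((1 + (1 / ν) * (y ⬝ᵥ y)) * t))) =
        t ^ (a - 1) * Real.exp (-t) * (y i * y j * Real.exp (-(t / ν) * (y ⬝ᵥ y))) := by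
    rw [show -((1 + (1 / ν) * (y ⬝ᵥ y)) * t) = -t + -(t / ν) * (y ⬝ᵥ y) by ring, Real.exp_add]
    ring
  simp_rw [key]
  rw [integral_const_mul, integral_mul_mul_exp_neg_mul_dotProduct (div_pos ht hν)]
  split_ifs
  · have h1 : √(Real.pi / (t / ν)) ^ Fintype.card ι =
        (Real.pi * ν) ^ ((Fintype.card ι : ℝ) / 2) * t ^ (-((Fintype.card ι : ℝ) / 2)) := by
      rw [Real.sqrt_eq_rpow, ← Real.rpow_natCast, ← Real.rpow_mul (by positivity),
        show Real.pi / (t / ν) = Real.pi * ν / t by field_simp, one_div_mul_eq_div,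
        Real.div_rpow (by positivity) ht.le, Real.rpow_neg ht.le, div_eq_mul_inv]
    have h2 : t ^ (a - 1) * t ^ (-((Fintype.card ι : ℝ) / 2)) * t⁻¹ = t ^ (ν / 2 - 1 - 1) := by
      rw [← Real.rpow_neg_one, ← Real.rpow_add ht, ← Real.rpow_add ht, ha]
      ring_nf
    rw [h1, ← h2]
    field_simp
  · simp

lemma integrable_gaussian_kernel_mul_gamma_weight_self {ν a : ℝ} (hν : 2 < ν)
    (ha : a = (ν + Fintype.card ι) / 2) (i : ι) :
    Integrable (fun z : (ι → ℝ) × ℝ => z.1 i * z.1 i *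
        (z.2 ^ (a - 1) * Real.exp (-((1 + (1 / ν) * (z.1 ⬝ᵥ z.1)) * z.2))))
      (volume.prod (volume.restrict (Set.Ioi 0))) := by
  have hν0 : 0 < ν := by linarith
  have hm : Measurable fun z : (ι → ℝ) × ℝ => z.1 i * z.1 i *
        (z.2 ^ (a - 1) * Real.exp (-((1 + (1 / ν) * (z.1 ⬝ᵥ z.1)) * z.2))) := by
    unfold dotProduct
    fun_prop
  rw [integrable_prod_iff' hm.aestronglyMeasurable]
  constructor
  · filter_upwards [ae_restrict_mem measurableSet_Ioi] with t ht
    have := (integrable_mul_mul_exp_neg_mul_dotProduct (div_pos ht hν0) i i).const_mul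
      (t ^ (a - 1) * Real.exp (-t))
    refine this.congr (.of_forall fun y => ?_)
    simp only
    rw [show -((1 + (1 / ν) * (y ⬝ᵥ y)) * t) = -t + -(t / ν) * (y ⬝ᵥ y) by ring, Real.exp_add]
    ring
  · have hint := (Real.GammaIntegral_convergent (s := ν / 2 - 1) (by linarith)).const_mul
      ((Real.pi * ν) ^ ((Fintype.card ι : ℝ) / 2) * (ν / 2))
    refine hint.congr ?_
    filter_upwards [ae_restrict_mem measurableSet_Ioi] with t ht
    have h := integral_gaussian_kernel_mul_gamma_weight hν0 ha ht i i
    rw [if_pos rfl] at h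
    rw [← h]
    refine integral_congr_ae (.of_forall fun y => ?_)
    have := Real.rpow_nonneg (le_of_lt ht) (a - 1)
    exact (Real.norm_of_nonneg (mul_nonneg (mul_self_nonneg _) (by positivity))).symm

lemma integrable_gaussian_kernel_mul_gamma_weight {ν a : ℝ} (hν : 2 < ν)
    (ha : a = (ν + Fintype.card ι) / 2) (i j : ι) :
    Integrable (fun z : (ι → ℝ) × ℝ => z.1 i * z.1 j *
        (z.2 ^ (a - 1) * Real.exp (-((1 + (1 / ν) * (z.1 ⬝ᵥ z.1)) * z.2))))
      (volume.prod (volume.restrict (Set.Ioi 0))) := by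
  have hm : Measurable fun z : (ι → ℝ) × ℝ => z.1 i * z.1 j *
        (z.2 ^ (a - 1) * Real.exp (-((1 + (1 / ν) * (z.1 ⬝ᵥ z.1)) * z.2))) := by
    unfold dotProduct
    fun_prop
  refine ((integrable_gaussian_kernel_mul_gamma_weight_self hν ha i).norm.add
    (integrable_gaussian_kernel_mul_gamma_weight_self hν ha j).norm).mono'
    hm.aestronglyMeasurable (.of_forall fun z => ?_)
  simp only [Pi.add_apply, norm_mul, ← add_mul]
  gcongr
  nlinarith [sq_nonneg (‖z.1 i‖ - ‖z.1 j‖), sq_nonneg (‖z.1 i‖ + ‖z.1 j‖)]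

lemma integrable_mul_mul_student_kernel {ν a : ℝ} (hν : 2 < ν)
    (ha : a = (ν + Fintype.card ι) / 2) (i j : ι) :
    Integrable fun y : ι → ℝ => y i * y j * (1 + (1 / ν) * (y ⬝ᵥ y)) ^ (-a) := by
  have hΓ : Real.Gamma a ≠ 0 := (Real.Gamma_pos_of_pos (by rw [ha]; positivity)).ne'
  have h := (integrable_gaussian_kernel_mul_gamma_weight hν ha i j).integral_prod_left
  simp only [integral_gamma_weight_mul hν ha] at h
  exact (integrable_mul_const_iff hΓ.isUnit _).1 h

lemma integral_mul_mul_student_kernel {ν a : ℝ} (hν : 2 < ν)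
    (ha : a = (ν + Fintype.card ι) / 2) (i j : ι) :
    ∫ y : ι → ℝ, y i * y j * (1 + (1 / ν) * (y ⬝ᵥ y)) ^ (-a) =
      if i = j then (Real.pi * ν) ^ ((Fintype.card ι : ℝ) / 2) * Real.Gamma (ν / 2) /
        Real.Gamma a * (ν / (ν - 2)) else 0 := by
  have hν0 : 0 < ν := by linarith
  have hΓ : Real.Gamma a ≠ 0 := (Real.Gamma_pos_of_pos (by rw [ha]; positivity)).ne'
  have h := integral_integral_swap (f := fun (y : ι → ℝ) (t : ℝ) => y i * y j *
    (t ^ (a - 1) * Real.exp (-((1 + (1 / ν) * (y ⬝ᵥ y)) * t))))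
    (integrable_gaussian_kernel_mul_gamma_weight hν ha i j)
  simp only [integral_gamma_weight_mul hν ha] at h
  rw [integral_mul_const, setIntegral_congr_fun measurableSet_Ioi fun t ht =>
    integral_gaussian_kernel_mul_gamma_weight hν0 ha ht i j, integral_const_mul,
    ← Real.Gamma_eq_integral (by linarith)] at h
  have hG : Real.Gamma (ν / 2) = (ν / 2 - 1) * Real.Gamma (ν / 2 - 1) := by
    rw [← Real.Gamma_add_one (by linarith), sub_add_cancel]
  rw [eq_div_of_mul_eq hΓ h, hG]
  have : ν - 2 ≠ 0 := by linarith
  split_ifs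
  · field_simp
  · simp

lemma integral_comp_mulVec {R : Matrix ι ι ℝ} (hR : R.det ≠ 0) {g : (ι → ℝ) → ℝ}
    (hg : Measurable g) : ∫ x, g x = |R.det| * ∫ y, g (R *ᵥ y) := by
  have hm : Measurable (toLin' R) :=
    (LinearMap.continuous_of_finiteDimensional (toLin' R)).measurable
  have h := integral_map (μ := volume) hm.aemeasurable hg.aestronglyMeasurable
  rw [Real.map_matrix_volume_pi_eq_smul_volume_pi hR, integral_smul_measure,
    ENNReal.toReal_ofReal (abs_nonneg _), abs_inv, smul_eq_mul] at h
  simp only [toLin'_apply] at h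
  rw [← h, mul_inv_cancel_left₀ (abs_ne_zero.2 hR)]

/-- The second moments of the (unnormalized) centred multivariate t density. -/
lemma integral_mul_mul_student_kernel_of_posDef {S : Matrix ι ι ℝ} (hS : S.PosDef) {ν a : ℝ}
    (hν : 2 < ν) (ha : a = (ν + Fintype.card ι) / 2) (p q : ι) :
    ∫ x : ι → ℝ, x p * x q * (1 + (1 / ν) * (x ⬝ᵥ (S⁻¹ *ᵥ x))) ^ (-a) =
      S.det ^ ((1 : ℝ) / 2) * ((Real.pi * ν) ^ ((Fintype.card ι : ℝ) / 2) * Real.Gamma (ν / 2) /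
        Real.Gamma a * (ν / (ν - 2))) * S p q := by
  obtain ⟨R, hRS⟩ : ∃ R : Matrix ι ι ℝ, S = R * Rᵀ := by
    open scoped MatrixOrder in
    obtain ⟨B, hB⟩ := CStarAlgebra.nonneg_iff_eq_star_mul_self.mp hS.posSemidef.nonneg
    exact ⟨Bᵀ, by simpa [star_eq_conjTranspose] using hB⟩
  have hdet : S.det = R.det ^ 2 := by rw [hRS, det_mul, det_transpose, sq]
  have hR : R.det ≠ 0 := fun h => hS.det_pos.ne' (by rw [hdet, h]; simp)
  have hRu : IsUnit R.det := hR.isUnit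
  have hquad (y : ι → ℝ) : (R *ᵥ y) ⬝ᵥ (S⁻¹ *ᵥ (R *ᵥ y)) = y ⬝ᵥ y := by
    rw [hRS, Matrix.mul_inv_rev, mulVec_mulVec, Matrix.mul_assoc, nonsing_inv_mul _ hRu,
      Matrix.mul_one, dotProduct_mulVec, vecMul_mulVec, ← transpose_nonsing_inv,
      ← transpose_mul, nonsing_inv_mul _ hRu]
    simp
  have hg : Measurable fun x : ι → ℝ =>
      x p * x q * (1 + (1 / ν) * (x ⬝ᵥ (S⁻¹ *ᵥ x))) ^ (-a) := by
    unfold mulVec dotProduct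
    fun_prop
  rw [integral_comp_mulVec hR hg]
  simp only [hquad]
  have hexp (y : ι → ℝ) : (R *ᵥ y) p * (R *ᵥ y) q * (1 + (1 / ν) * (y ⬝ᵥ y)) ^ (-a) =
      ∑ k, ∑ l, R p k * R q l * (y k * y l * (1 + (1 / ν) * (y ⬝ᵥ y)) ^ (-a)) := by
    rw [mulVec, mulVec, dotProduct, dotProduct, Finset.sum_mul_sum, Finset.sum_mul]
    simp only [Finset.sum_mul]
    exact Finset.sum_congr rfl fun k _ => Finset.sum_congr rfl fun l _ => by ring
  simp only [hexp]
  have hi (k l : ι) := (integrable_mul_mul_student_kernel hν ha k l).const_mul (R p k * R q l)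
  rw [integral_finsetSum _ fun k _ => integrable_finsetSum _ fun l _ => hi k l]
  simp only [integral_finsetSum _ fun l _ => hi _ l, integral_const_mul,
    integral_mul_mul_student_kernel hν ha, mul_ite, mul_zero, Finset.sum_ite_eq,
    Finset.mem_univ, if_true]
  rw [← Finset.sum_mul, hdet, ← Real.sqrt_eq_rpow, Real.sqrt_sq_eq_abs, hRS, mul_apply]
  simp only [transpose_apply]
  ring

end Gaussian

lemma measurePreserving_vecM (c r : ℕ) :
    MeasurePreserving (fun X : Fin c → Fin r → ℝ => vecM (Matrix.of X)) := by
  have hm : Measurable (fun X : Fin c → Fin r → ℝ => vecM (Matrix.of X)) := by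
    refine measurable_pi_lambda _ fun p => ?_
    change Measurable fun X : Fin c → Fin r → ℝ => X p.2 p.1
    fun_prop
  refine ⟨hm, (Measure.pi_eq fun s hs => ?_).symm⟩
  rw [Measure.map_apply hm (.univ_pi hs)]
  have : (fun X : Fin c → Fin r → ℝ => vecM (Matrix.of X)) ⁻¹' Set.univ.pi s =
      Set.univ.pi fun i => Set.univ.pi fun j => s (j, i) := by
    ext X
    simp only [vecM, Set.mem_preimage, Set.mem_univ_pi, Prod.forall, Matrix.of_apply]
    exact forall_comm
  rw [this, volume_pi_pi]
  simp_rw [volume_pi_pi]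
  rw [Fintype.prod_prod_type_right]

lemma trace_eq_vecM_dotProduct {c r : ℕ} {Sc : Matrix (Fin c) (Fin c) ℝ}
    {Sr : Matrix (Fin r) (Fin r) ℝ} (hSr : Srᵀ = Sr) (Y : Matrix (Fin c) (Fin r) ℝ) :
    (Sc⁻¹ * Y * Sr⁻¹ * Yᵀ).trace = vecM Y ⬝ᵥ ((Sr ⊗ₖ Sc)⁻¹ *ᵥ vecM Y) := by
  change _ = Y.vec ⬝ᵥ ((Sr ⊗ₖ Sc)⁻¹ *ᵥ Y.vec)
  rw [inv_kronecker, kronecker_mulVec_vec, vec_dotProduct_vec, transpose_nonsing_inv, hSr,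
    trace_mul_comm]
/-- For `ν > 2`, the covariance matrix of `vec(X)` under the matrix-variate t
density equals `(ν/(ν−2)) Σ_r ⊗ Σ_c` (stated entrywise, with the integral taken
over all real `c×r` matrices w.r.t. Lebesgue measure on the `cr` entries). -/
theorem matT_covariance_eq_kronecker
    (c r : ℕ) (hc : 0 < c) (hr : 0 < r)
    (M : Matrix (Fin c) (Fin r) ℝ)
    (Sc : Matrix (Fin c) (Fin c) ℝ) (Sr : Matrix (Fin r) (Fin r) ℝ)
    (hSc : Sc.PosDef) (hSr : Sr.PosDef) (ν : ℝ) (hν : 2 < ν) :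
    ∀ p q : Fin r × Fin c,
      (∫ X : Fin c → Fin r → ℝ,
          (vecM (Matrix.of X) p - vecM M p) * (vecM (Matrix.of X) q - vecM M q) *
            matTPdf (Matrix.of X) M Sc Sr ν)
        = (ν / (ν - 2)) * (Sr ⊗ₖ Sc) p q := by
  intro p q
  have hSrT : Srᵀ = Sr := by simpa using hSr.isHermitian.eq
  have hcard : (Fintype.card (Fin r × Fin c) : ℝ) = c * r := by simp [mul_comm]
  have hc0 := hSc.det_pos
  have hr0 := hSr.det_pos
  set C := Sc.det ^ (-(r : ℝ) / 2) * Sr.det ^ (-(c : ℝ) / 2) *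
    Real.Gamma ((ν + (c : ℝ) * r) / 2) /
      ((Real.pi * ν) ^ (((c * r : ℕ) : ℝ) / 2) * Real.Gamma (ν / 2)) with hC
  set a := (ν + (c : ℝ) * r) / 2 with ha
  have key := integral_mul_mul_student_kernel_of_posDef (hSr.kronecker hSc) (a := a) hν
    (by rw [hcard]) p q
  set g : (Fin r × Fin c → ℝ) → ℝ := fun x =>
    x p * x q * (1 + (1 / ν) * (x ⬝ᵥ ((Sr ⊗ₖ Sc)⁻¹ *ᵥ x))) ^ (-a) with hg
  have hgm : Measurable g := by
    unfold g mulVec dotProduct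
    fun_prop
  have hpt (X : Fin c → Fin r → ℝ) :
      (vecM (Matrix.of X) p - vecM M p) * (vecM (Matrix.of X) q - vecM M q) *
        matTPdf (Matrix.of X) M Sc Sr ν = C * g (vecM (Matrix.of (X - Matrix.of.symm M))) := by
    rw [matTPdf, trace_eq_vecM_dotProduct hSrT, ← hC, neg_div, ← ha]
    simp only [hg]
    change _ = C * ((vecM (Matrix.of X) p - vecM M p) * (vecM (Matrix.of X) q - vecM M q) *
      (1 + (1 / ν) * (vecM (Matrix.of X - M) ⬝ᵥ
        ((Sr ⊗ₖ Sc)⁻¹ *ᵥ vecM (Matrix.of X - M)))) ^ (-a))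
    ring
  have hmp := measurePreserving_vecM c r
  simp only [hpt]
  rw [integral_const_mul,
    integral_sub_right_eq_self (fun X : Fin c → Fin r → ℝ => g (vecM (Matrix.of X)))
      (Matrix.of.symm M),
    ← integral_map hmp.measurable.aemeasurable hgm.aestronglyMeasurable, hmp.map_eq, key,
    det_kronecker, hcard, hC]
  have hΓa : Real.Gamma a ≠ 0 := (Real.Gamma_pos_of_pos (by positivity)).ne'
  have hΓν : Real.Gamma (ν / 2) ≠ 0 := (Real.Gamma_pos_of_pos (by positivity)).ne'
  have hπ : (Real.pi * ν) ^ ((c : ℝ) * r / 2) ≠ 0 := by positivity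
  have h1 : (Sr.det ^ c * Sc.det ^ r) ^ ((1 : ℝ) / 2) =
      Sr.det ^ ((c : ℝ) / 2) * Sc.det ^ ((r : ℝ) / 2) := by
    rw [Real.mul_rpow (by positivity) (by positivity), ← Real.rpow_natCast, ← Real.rpow_natCast,
      ← Real.rpow_mul hr0.le, ← Real.rpow_mul hc0.le, mul_one_div, mul_one_div]
  simp only [Fintype.card_fin, Nat.cast_mul]
  rw [h1, neg_div, neg_div, Real.rpow_neg hc0.le, Real.rpow_neg hr0.le]
  have hc1 := (Real.rpow_pos_of_pos hc0 ((r : ℝ) / 2)).ne'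
  have hr1 := (Real.rpow_pos_of_pos hr0 ((c : ℝ) / 2)).ne'
  field_simp
end

section
/- Let c, r be positive integers, M a real c×r matrix, Σ_c a positive definite c×c matrix, Σ_r a positive definite r×r matrix, and ν > 0. Then the matrix-variate t density integrates to one: ∫_{ℝ^{c×r}} Mt_{c,r}(X; M, Σ_c, Σ_r, ν) dX = 1, where the integral is over all real c×r matrices X with respect to Lebesgue measure on the cr entries. -/
open Matrix MeasureTheory

section Factorization

open scoped MatrixOrder Matrix.Norms.L2Operator

/-- A real positive definite matrix factors as `Lᵀ * L`. -/
theorem Matrix.PosDef.exists_eq_transpose_mul_self {ι : Type*} [Fintype ι] [DecidableEq ι]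
    {S : Matrix ι ι ℝ} (hS : S.PosDef) : ∃ L : Matrix ι ι ℝ, S = Lᵀ * L := by
  obtain ⟨L, hL⟩ := CStarAlgebra.nonneg_iff_eq_star_mul_self.mp hS.posSemidef.nonneg
  exact ⟨L, by simpa [star_eq_conjTranspose] using hL⟩

end Factorization

/-- A positive definite quadratic form can be normalized under the integral sign. -/
theorem integral_comp_quadraticForm_inv {ι : Type*} [Fintype ι] [DecidableEq ι]
    {S : Matrix ι ι ℝ} (hS : S.PosDef) (f : ℝ → ℝ) :
    ∫ y : ι → ℝ, f (y ⬝ᵥ S⁻¹ *ᵥ y) = √S.det * ∫ y : ι → ℝ, f (y ⬝ᵥ y) := by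
  obtain ⟨L, hL⟩ := hS.inv.exists_eq_transpose_mul_self
  have hdet : L.det * L.det = S.det⁻¹ := by
    rw [← Ring.inverse_eq_inv', ← Matrix.det_nonsing_inv, hL, det_mul, det_transpose]
  have hL0 : L.det ≠ 0 := by
    intro h
    have := hS.det_pos.ne'
    simp_all
  have hsqrt : √S.det = |L.det⁻¹| := by
    rw [← Real.sqrt_sq_eq_abs, inv_pow, sq, hdet, inv_inv]
  have hform (y : ι → ℝ) : y ⬝ᵥ S⁻¹ *ᵥ y = toLin' L y ⬝ᵥ toLin' L y := by
    rw [hL, toLin'_apply, ← mulVec_mulVec, dotProduct_mulVec, vecMul_transpose]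
  have hemb : MeasurableEmbedding (toLin' L) := by
    have hLu : IsUnit L.det := hL0.isUnit
    exact ((LinearEquiv.ofIsUnitDet (f := toLin' L) (v := Pi.basisFun ℝ ι) (v' := Pi.basisFun ℝ ι)
      (by simpa using hLu)).toContinuousLinearEquiv.toHomeomorph).measurableEmbedding
  simp_rw [hform]
  rw [← hemb.integral_map (fun z => f (z ⬝ᵥ z)),
    Real.map_matrix_volume_pi_eq_smul_volume_pi hL0, integral_smul_measure,
    ENNReal.toReal_ofReal (abs_nonneg _), hsqrt, smul_eq_mul]

/-- Vectorization of matrices preserves Lebesgue measure. -/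
theorem integral_comp_vec {m n : Type*} [Fintype m] [Fintype n] (g : (n × m → ℝ) → ℝ) :
    ∫ X : m → n → ℝ, g (vec (Matrix.of X)) = ∫ y, g y := by
  let e : (m → n → ℝ) ≃ᵐ (n × m → ℝ) :=
    (MeasurableEquiv.curry m n ℝ).symm.trans
      (MeasurableEquiv.piCongrLeft (fun _ => ℝ) (Equiv.prodComm m n))
  have he (X : m → n → ℝ) : e X = vec (Matrix.of X) := by
    ext p
    rfl
  have hmp : MeasurePreserving e := by
    refine ⟨e.measurable, (Measure.pi_eq fun s hs => ?_).symm⟩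
    rw [e.map_apply]
    have : e ⁻¹' Set.univ.pi s = Set.univ.pi fun i => Set.univ.pi fun j => s (j, i) := by
      ext X
      simp only [Set.mem_preimage, Set.mem_univ_pi, he, vec, Matrix.of_apply]
      exact ⟨fun h i j => h (j, i), fun h p => h p.2 p.1⟩
    rw [this, volume_pi_pi]
    simp_rw [volume_pi_pi]
    rw [Fintype.prod_prod_type_right]
  simp_rw [← he]
  exact hmp.integral_comp' g

/-- The centred isotropic Gaussian integral over `ι → ℝ`. -/
theorem integral_exp_neg_mul_dotProduct {ι : Type*} [Fintype ι] {b : ℝ} (hb : 0 < b) :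
    ∫ y : ι → ℝ, Real.exp (-b * (y ⬝ᵥ y)) = (Real.pi / b) ^ ((Fintype.card ι : ℝ) / 2) := by
  have h (y : ι → ℝ) : Real.exp (-b * (y ⬝ᵥ y)) = ∏ i, Real.exp (-b * y i ^ 2) := by
    rw [← Real.exp_sum, dotProduct, Finset.mul_sum]
    simp_rw [sq]
  simp_rw [h]
  rw [integral_fintype_prod_volume_eq_pow (fun x : ℝ => Real.exp (-b * x ^ 2)),
    integral_gaussian, Real.sqrt_eq_rpow, ← Real.rpow_mul_natCast (by positivity)]
  ring_nf

theorem integrable_exp_neg_mul_dotProduct {ι : Type*} [Fintype ι] {b : ℝ} (hb : 0 < b) :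
    Integrable fun y : ι → ℝ => Real.exp (-b * (y ⬝ᵥ y)) := by
  have h (y : ι → ℝ) : Real.exp (-b * (y ⬝ᵥ y)) = ∏ i, Real.exp (-b * y i ^ 2) := by
    rw [← Real.exp_sum, dotProduct, Finset.mul_sum]
    simp_rw [sq]
  simp_rw [h]
  exact Integrable.fintype_prod fun _ => integrable_exp_neg_mul_sq hb

/-- The normalizing integral of the standard multivariate t distribution. -/
theorem integral_one_add_dotProduct_rpow (ι : Type*) [Fintype ι] {ν : ℝ} (hν : 0 < ν) :
    ∫ y : ι → ℝ, (1 + (1 / ν) * (y ⬝ᵥ y)) ^ (-(ν + Fintype.card ι) / 2) =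
      (Real.pi * ν) ^ ((Fintype.card ι : ℝ) / 2) * Real.Gamma (ν / 2) /
        Real.Gamma ((ν + Fintype.card ι) / 2) := by
  set n : ℝ := (Fintype.card ι : ℝ) with hn
  have hn0 : 0 ≤ n := Nat.cast_nonneg _
  set a : ℝ := (ν + n) / 2 with ha
  have ha0 : 0 < a := by positivity
  let F : ℝ → (ι → ℝ) → ℝ := fun t y =>
    t ^ (a - 1) * Real.exp (-t) * Real.exp (-(t / ν) * (y ⬝ᵥ y))
  have hFt (t : ℝ) (ht : t ∈ Set.Ioi (0 : ℝ)) :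
      ∫ y, F t y = (Real.pi * ν) ^ (n / 2) * (Real.exp (-t) * t ^ (ν / 2 - 1)) := by
    have ht' : 0 < t := ht
    simp only [F]
    rw [integral_const_mul, integral_exp_neg_mul_dotProduct (by positivity), ← hn,
      div_div_eq_mul_div, Real.div_rpow (by positivity) ht'.le,
      show ν / 2 - 1 = (a - 1) - n / 2 by rw [ha]; ring, Real.rpow_sub ht' (a - 1) (n / 2)]
    ring
  have hFy (y : ι → ℝ) : ∫ t in Set.Ioi 0, F t y =
      (1 + (1 / ν) * (y ⬝ᵥ y)) ^ (-a) * Real.Gamma a := by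
    have hy : 0 ≤ y ⬝ᵥ y := Finset.sum_nonneg fun i _ => mul_self_nonneg _
    have hpos : 0 < 1 + (1 / ν) * (y ⬝ᵥ y) := by positivity
    rw [Real.rpow_neg hpos.le, ← Real.inv_rpow hpos.le, inv_eq_one_div,
      ← Real.integral_rpow_mul_exp_neg_mul_Ioi ha0 hpos]
    congr with t
    simp only [F]
    rw [mul_assoc, ← Real.exp_add]
    ring_nf
  have hmeas : Measurable (Function.uncurry F) := by
    simp only [F, Function.uncurry_def, dotProduct]
    fun_prop
  have hF : Integrable (Function.uncurry F)
      ((volume.restrict (Set.Ioi 0)).prod (volume : Measure (ι → ℝ))) := by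
    rw [integrable_prod_iff hmeas.aestronglyMeasurable]
    constructor
    · filter_upwards [ae_restrict_mem measurableSet_Ioi] with t ht
      have ht' : 0 < t := ht
      exact (integrable_exp_neg_mul_dotProduct (ι := ι) (div_pos ht' hν)).const_mul
        (t ^ (a - 1) * Real.exp (-t))
    · refine Integrable.congr
        ((Real.GammaIntegral_convergent (half_pos hν)).const_mul ((Real.pi * ν) ^ (n / 2))) ?_
      filter_upwards [ae_restrict_mem measurableSet_Ioi] with t ht
      have ht' : 0 < t := ht
      rw [← hFt t ht]
      refine integral_congr_ae (.of_forall fun y => ?_)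
      simp only [F, Function.uncurry_apply_pair]
      exact (Real.norm_of_nonneg (by positivity)).symm
  have hswap := integral_integral_swap hF
  simp_rw [hFy] at hswap
  rw [setIntegral_congr_fun measurableSet_Ioi hFt, integral_const_mul, integral_mul_const,
    ← Real.Gamma_eq_integral (half_pos hν)] at hswap
  rw [eq_div_iff (Real.Gamma_pos_of_pos ha0).ne', hswap, neg_div]

open scoped Kronecker in
/-- The trace form of the matrix-variate t density, as a quadratic form in the vectorization. -/
theorem trace_inv_mul_mul_inv_mul_transpose {m n : Type*} [Fintype m] [Fintype n]
    [DecidableEq m] [DecidableEq n] (S : Matrix m m ℝ) {T : Matrix n n ℝ} (hT : T.IsSymm)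
    (Y : Matrix m n ℝ) :
    (S⁻¹ * Y * T⁻¹ * Yᵀ).trace = vec Y ⬝ᵥ (T ⊗ₖ S)⁻¹ *ᵥ vec Y := by
  rw [inv_kronecker, kronecker_mulVec_vec, vec_dotProduct_vec, transpose_nonsing_inv, hT.eq,
    trace_mul_comm]

open scoped Kronecker in
/-- The matrix-variate t density integrates to one over all real `c×r` matrices
(w.r.t. Lebesgue measure on the `cr` entries). -/
theorem matT_integrates_to_one
    (c r : ℕ) (hc : 0 < c) (hr : 0 < r)
    (M : Matrix (Fin c) (Fin r) ℝ)
    (Sc : Matrix (Fin c) (Fin c) ℝ) (Sr : Matrix (Fin r) (Fin r) ℝ)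
    (hSc : Sc.PosDef) (hSr : Sr.PosDef) (ν : ℝ) (hν : 0 < ν) :
    ∫ X : Fin c → Fin r → ℝ, matTPdf (Matrix.of X) M Sc Sr ν = 1 := by
  have hdet : √(Sr ⊗ₖ Sc).det = Sr.det ^ ((c : ℝ) / 2) * Sc.det ^ ((r : ℝ) / 2) := by
    rw [det_kronecker, Real.sqrt_eq_rpow, Real.mul_rpow (pow_nonneg hSr.det_pos.le _)
      (pow_nonneg hSc.det_pos.le _), ← Real.rpow_natCast_mul hSr.det_pos.le,
      ← Real.rpow_natCast_mul hSc.det_pos.le]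
    simp only [Fintype.card_fin, mul_one_div]
  have hT : Sr.IsSymm := by simpa [IsHermitian, IsSymm] using hSr.isHermitian
  let f : ℝ → ℝ := fun q => (1 + (1 / ν) * q) ^ (-(ν + (c : ℝ) * r) / 2)
  have hshift := integral_sub_right_eq_self (μ := (volume : Measure (Fin c → Fin r → ℝ)))
    (fun Y => f ((Sc⁻¹ * Matrix.of Y * Sr⁻¹ * (Matrix.of Y)ᵀ).trace)) M
  have hcard : (Fintype.card (Fin r × Fin c) : ℝ) = (c : ℝ) * r := by
    simp [mul_comm]
  have hmain : ∫ X : Fin c → Fin r → ℝ,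
      f ((Sc⁻¹ * (Matrix.of X - M) * Sr⁻¹ * (Matrix.of X - M)ᵀ).trace) =
      Sr.det ^ ((c : ℝ) / 2) * Sc.det ^ ((r : ℝ) / 2) *
        ((Real.pi * ν) ^ ((c : ℝ) * r / 2) * Real.Gamma (ν / 2) /
          Real.Gamma ((ν + (c : ℝ) * r) / 2)) := by
    refine hshift.trans ?_
    simp_rw [trace_inv_mul_mul_inv_mul_transpose Sc hT]
    rw [integral_comp_vec (fun y => f (y ⬝ᵥ (Sr ⊗ₖ Sc)⁻¹ *ᵥ y)),
      integral_comp_quadraticForm_inv (hSr.kronecker hSc) f, hdet, ← hcard,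
      ← integral_one_add_dotProduct_rpow _ hν]
    simp only [f, hcard]
  simp only [matTPdf]
  rw [integral_const_mul]
  refine (congrArg _ hmain).trans ?_
  have h1 : 0 < Real.Gamma ((ν + (c : ℝ) * r) / 2) := Real.Gamma_pos_of_pos (by positivity)
  have h2 : 0 < Real.Gamma (ν / 2) := Real.Gamma_pos_of_pos (by positivity)
  have h3 : 0 < Sc.det ^ ((r : ℝ) / 2) := Real.rpow_pos_of_pos hSc.det_pos _
  have h4 : 0 < Sr.det ^ ((c : ℝ) / 2) := Real.rpow_pos_of_pos hSr.det_pos _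
  have h5 : 0 < (Real.pi * ν) ^ ((c : ℝ) * r / 2) := by positivity
  rw [neg_div, neg_div, Real.rpow_neg hSc.det_pos.le, Real.rpow_neg hSr.det_pos.le, Nat.cast_mul]
  field_simp
end
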